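/- For any positive reals b and ε there exists a constant N such that the following holds for every n ≥ N. Let G be a d-regular simple graph on n vertices with ln^{1+6b+12ε} n ≤ d ≤ n/ln^{2b+5ε} n, and let U = U₁ ∪ … ∪ U₇ ⊆ V(G) be a partition satisfying | |U_i| − (1/7)·n/ln^{b+ε} n | ≤ (1/7)·n/ln^{2b+4ε} n and | d_{U_i}(v) − (1/7)·d/ln^{b+ε} n | ≤ (1/7)·d/ln^{2b+4ε} n for every v ∈ V(G) and i ∈ {1,…,7}. Then for every v ∈ U and every i ∈ {1,…,7}: 2·|U_i| < d_U(v)·⌊n/(3d)⌋ + 1; indeed d_U(v)·⌊n/(3d)⌋ + 1 > (2n/(7 ln^{b+ε} n))·(1 + 1/ln^{b+3ε} n). -/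

import Mathlib

open Finset

/-- `degIn G v S` is the number of neighbours of `v` lying in the set `S`. -/
def degIn {V : Type} [Fintype V] [DecidableEq V] (G : SimpleGraph V) [DecidableRel G.Adj]
    (v : V) (S : Finset V) : ℕ :=
  (G.neighborFinset v ∩ S).card

open Filter in
theorem eventually_le_log_natCast_rpow {a : ℝ} (ha : 0 < a) (C : ℝ) :
    ∀ᶠ n : ℕ in atTop, C ≤ Real.log n ^ a :=
  ((tendsto_rpow_atTop ha).comp
    (Real.tendsto_log_atTop.comp tendsto_natCast_atTop_atTop)).eventually_ge_atTop C

theorem degIn_biUnion {V ι : Type} [Fintype V] [DecidableEq V] [Fintype ι] (G : SimpleGraph V)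
    [DecidableRel G.Adj] (v : V) (U : ι → Finset V)
    (hU : ∀ i j : ι, i ≠ j → Disjoint (U i) (U j)) :
    degIn G v (Finset.univ.biUnion U) = ∑ i, degIn G v (U i) := by
  unfold degIn
  rw [Finset.inter_biUnion, Finset.card_biUnion]
  intro i _ j _ hij
  exact (hU i j hij).mono Finset.inter_subset_right Finset.inter_subset_right

/-- The numerical core: `x`, `y`, `z` stand for powers of `log n`, `D` for the degree into `U`
and `f` for the integer part of `n / (3 * d)`. -/
theorem two_sevenths_lt_mul_add_one {n d x y z D f : ℝ} (hn : 0 < n) (hd : 0 < d) (hx : 0 < x)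
    (hy : 100 ≤ y) (hz : 100 ≤ z) (hdn : d ≤ n / z) (hD : d / x - d / (x * y) ≤ D)
    (hf₀ : 0 ≤ f) (hf : n / (3 * d) - 1 ≤ f) :
    2 * n / (7 * x) * (1 + 1 / y) < D * f + 1 := by
  have hy' : 1 / y ≤ 1 / 100 := one_div_le_one_div_of_le (by norm_num) hy
  have hd' : d ≤ n / 100 := hdn.trans (by gcongr)
  have hnx : 0 < n / x := by positivity
  have hDlow : d / x * (99 / 100) ≤ D := by
    have h : d / (x * y) = d / x * (1 / y) := by field_simp
    have : d / x * (1 / y) ≤ d / x * (1 / 100) := by gcongr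
    linarith
  calc 2 * n / (7 * x) * (1 + 1 / y) = n / x * (2 / 7 * (1 + 1 / y)) := by field_simp
    _ ≤ n / x * (99 / 100 * (1 / 3 - 1 / 100)) := mul_le_mul_of_nonneg_left (by linarith) hnx.le
    _ = 99 / 100 * ((n / 3 - n / 100) / x) := by field_simp
    _ ≤ 99 / 100 * ((n / 3 - d) / x) := by gcongr
    _ = d / x * (99 / 100) * (n / (3 * d) - 1) := by field_simp
    _ ≤ d / x * (99 / 100) * f := by gcongr
    _ ≤ D * f := by gcongr
    _ < D * f + 1 := lt_add_one _

theorem many_options_in_U (b ε : ℝ) (hb : 0 < b) (hε : 0 < ε) :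
    ∃ N : ℕ, ∀ (V : Type) [Fintype V] [DecidableEq V] (G : SimpleGraph V)
      [DecidableRel G.Adj] (n d : ℕ) (U : Fin 7 → Finset V),
      n = Fintype.card V → G.IsRegularOfDegree d → N ≤ n →
      Real.log n ^ (1 + 6 * b + 12 * ε) ≤ (d : ℝ) →
      (d : ℝ) ≤ (n : ℝ) / Real.log n ^ (2 * b + 5 * ε) →
      -- U = U₁ ∪ … ∪ U₇ is a partition
      (∀ i j : Fin 7, i ≠ j → Disjoint (U i) (U j)) →
      -- (1°)
      (∀ i : Fin 7,
        |((U i).card : ℝ) - (1 / 7) * ((n : ℝ) / Real.log n ^ (b + ε))| ≤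
          (1 / 7) * ((n : ℝ) / Real.log n ^ (2 * b + 4 * ε))) →
      -- (2°)
      (∀ v : V, ∀ i : Fin 7,
        |(degIn G v (U i) : ℝ) - (1 / 7) * ((d : ℝ) / Real.log n ^ (b + ε))| ≤
          (1 / 7) * ((d : ℝ) / Real.log n ^ (2 * b + 4 * ε))) →
      ∀ v ∈ Finset.univ.biUnion U, ∀ i : Fin 7,
        2 * (U i).card <
          degIn G v (Finset.univ.biUnion U) * ⌊(n : ℝ) / (3 * (d : ℝ))⌋₊ + 1 ∧
        2 * (n : ℝ) / (7 * Real.log n ^ (b + ε)) * (1 + 1 / Real.log n ^ (b + 3 * ε)) <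
          (degIn G v (Finset.univ.biUnion U) : ℝ) * (⌊(n : ℝ) / (3 * (d : ℝ))⌋₊ : ℝ) + 1 := by
  obtain ⟨N, hN⟩ := Filter.eventually_atTop.mp
    ((eventually_le_log_natCast_rpow (a := b + 3 * ε) (by positivity) 100).and
      ((eventually_le_log_natCast_rpow (a := 2 * b + 5 * ε) (by positivity) 100).and
        (eventually_le_log_natCast_rpow one_pos 1)))
  refine ⟨N, ?_⟩
  intro V _ _ G _ n d U _ _ hNn hdlow hdup hdisj hcard hdeg v _ i
  obtain ⟨hy, hz, hlog⟩ := hN n hNn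
  rw [Real.rpow_one] at hlog
  have hL : 0 < Real.log n := one_pos.trans_le hlog
  have hn : (0 : ℝ) < n :=
    (Nat.cast_nonneg n).lt_of_ne fun h => by simp [← h] at hL
  have hd : (0 : ℝ) < d := (Real.rpow_pos_of_pos hL _).trans_le hdlow
  have hx : 0 < Real.log n ^ (b + ε) := Real.rpow_pos_of_pos hL _
  have hxy : Real.log n ^ (2 * b + 4 * ε)
      = Real.log n ^ (b + ε) * Real.log n ^ (b + 3 * ε) := by
    rw [← Real.rpow_add hL]
    ring_nf
  rw [hxy] at hcard hdeg
  set x := Real.log n ^ (b + ε)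
  set y := Real.log n ^ (b + 3 * ε)
  have hD : (d : ℝ) / x - d / (x * y) ≤ degIn G v (Finset.univ.biUnion U) := by
    rw [degIn_biUnion G v U hdisj, Nat.cast_sum]
    calc (d : ℝ) / x - d / (x * y)
        = ∑ _j : Fin 7, (1 / 7 * ((d : ℝ) / x) - 1 / 7 * (d / (x * y))) := by
          rw [Finset.sum_const, Finset.card_univ, Fintype.card_fin]
          ring
      _ ≤ ∑ j, (degIn G v (U j) : ℝ) :=
          Finset.sum_le_sum fun j _ => by linarith [(abs_le.mp (hdeg v j)).1]
  have hmain := two_sevenths_lt_mul_add_one hn hd hx hy hz hdup hD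
    (Nat.cast_nonneg ⌊(n : ℝ) / (3 * d)⌋₊) (Nat.sub_one_lt_floor _).le
  refine ⟨?_, hmain⟩
  have hUi : 2 * ((U i).card : ℝ) ≤ 2 * n / (7 * x) * (1 + 1 / y) := by
    have h : 2 * (n : ℝ) / (7 * x) * (1 + 1 / y)
        = 2 * (1 / 7 * (n / x) + 1 / 7 * (n / (x * y))) := by
      field_simp
    linarith [(abs_le.mp (hcard i)).2]
  exact_mod_cast hUi.trans_lt hmain
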